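/- arXiv:2105.10171 — 6 statements merged into one kernel-verified Lean document; each statement's English description precedes it below -/
import Mathlib

section
/- Derivation property for the magnetic co-boundary operator: for every finitely supported f : V → ℂ and every finitely supported skewsymmetric φ : E → ℂ, and for every vertex x ∈ V, one has δ⁰_α(f̃ φ)(x) = f(x) · (δ⁰_α φ)(x) − (1/(2c(x))) ∑_{y ∼ x} r(x,y) e^{−iα(x,y)/2} (f(y) − f(x)) φ(x,y), where f̃(x,y) := (f(x)+f(y))/2. -/
open Complex Function

open scoped Classical

/-- A weighted magnetic triangulation: a connected, locally finite, loop-free symmetric graph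
on an (at most countable) vertex set `V`, together with a symmetric set of triangular faces,
a skewsymmetric magnetic potential `α` on edges, and positive symmetric weights on vertices,
edges and faces. -/
structure MagneticTriangulation (V : Type*) where
  E : Set (V × V)
  F : Set (V × V × V)
  α : V → V → ℝ
  c : V → ℝ
  r : V → V → ℝ
  s : V → V → V → ℝ
  no_loops : ∀ x : V, (x, x) ∉ E
  E_symm : ∀ x y : V, (x, y) ∈ E → (y, x) ∈ E
  locally_finite : ∀ x : V, {y : V | (x, y) ∈ E}.Finite
  connected : ∀ x y : V, Relation.ReflTransGen (fun a b => (a, b) ∈ E) x y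
  F_edge : ∀ x y z : V, (x, y, z) ∈ F → (x, y) ∈ E ∧ (y, z) ∈ E ∧ (z, x) ∈ E
  F_symm_swap : ∀ x y z : V, (x, y, z) ∈ F → (y, x, z) ∈ F
  F_symm_cyc : ∀ x y z : V, (x, y, z) ∈ F → (y, z, x) ∈ F
  α_skew : ∀ x y : V, (x, y) ∈ E → α x y = - α y x
  c_pos : ∀ x : V, 0 < c x
  r_pos : ∀ x y : V, (x, y) ∈ E → 0 < r x y
  r_symm : ∀ x y : V, r x y = r y x
  s_pos : ∀ x y z : V, (x, y, z) ∈ F → 0 < s x y z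
  s_symm_swap : ∀ x y z : V, s x y z = s y x z
  s_symm_cyc : ∀ x y z : V, s x y z = s y z x

variable {V : Type*}

/-- The magnetic difference operator `d⁰_α` (a `1`-cochain supported on the edge set). -/
noncomputable def dZero (T : MagneticTriangulation V) (g : V → ℂ) : V × V → ℂ :=
  fun p => if p ∈ T.E then
      Complex.exp (Complex.I * (T.α p.2 p.1 : ℂ) / 2) * g p.2
        - Complex.exp (Complex.I * (T.α p.1 p.2 : ℂ) / 2) * g p.1
    else 0

/-- The magnetic co-boundary operator `δ⁰_α`. -/
noncomputable def deltaZero (T : MagneticTriangulation V) (φ : V × V → ℂ) : V → ℂ :=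
  fun x => (T.c x : ℂ)⁻¹ *
    ∑ᶠ y ∈ {y : V | (y, x) ∈ T.E},
      (T.r y x : ℂ) * Complex.exp (Complex.I * (T.α y x : ℂ) / 2) * φ (y, x)

/-- The exterior magnetic derivative `d¹_α` (a `2`-cochain supported on the face set). -/
noncomputable def dOne (T : MagneticTriangulation V) (φ : V × V → ℂ) : V × V × V → ℂ :=
  fun q => if q ∈ T.F then
      Complex.exp (Complex.I / 6 * ((T.α q.1 q.2.2 + T.α q.2.1 q.2.2 : ℝ) : ℂ)) * φ (q.1, q.2.1)
      + Complex.exp (Complex.I / 6 * ((T.α q.2.1 q.1 + T.α q.2.2 q.1 : ℝ) : ℂ)) * φ (q.2.1, q.2.2)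
      + Complex.exp (Complex.I / 6 * ((T.α q.2.2 q.2.1 + T.α q.1 q.2.1 : ℝ) : ℂ)) * φ (q.2.2, q.1)
    else 0

/-- The co-exterior magnetic derivative `δ¹_α`. -/
noncomputable def deltaOne (T : MagneticTriangulation V) (ψ : V × V × V → ℂ) : V × V → ℂ :=
  fun p => (T.r p.1 p.2 : ℂ)⁻¹ *
    ∑ᶠ t ∈ {t : V | (p.1, p.2, t) ∈ T.F},
      (T.s p.1 p.2 t : ℂ) *
        Complex.exp (Complex.I / 6 * ((T.α t p.1 + T.α t p.2 : ℝ) : ℂ)) * ψ (p.1, p.2, t)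

/-- The holonomy of the magnetic potential on a face. -/
def hatAlpha (T : MagneticTriangulation V) (x y z : V) : ℝ := T.α x y + T.α y z + T.α z x

/-- Replacing the magnetic potential of a magnetic triangulation. -/
def MagneticTriangulation.replacePotential (T : MagneticTriangulation V) (β : V → V → ℝ)
    (hβ : ∀ x y : V, (x, y) ∈ T.E → β x y = - β y x) : MagneticTriangulation V :=
  { T with α := β, α_skew := hβ }

/-- **Derivation property for the magnetic co-boundary operator**: for every finitely
supported `f : V → ℂ` and every finitely supported skewsymmetric `φ` on the edges, and every
vertex `x`,
`δ⁰_α(f̃ φ)(x) = f(x) (δ⁰_α φ)(x) − (1/(2c(x))) ∑_{y ∼ x} r(x,y) e^{−iα(x,y)/2} (f(y) − f(x)) φ(x,y)`,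
where `f̃(x,y) = (f(x) + f(y))/2`. -/
theorem deltaZero_derivation [Countable V] (T : MagneticTriangulation V)
    (f : V → ℂ) (hf : (Function.support f).Finite)
    (φ : V × V → ℂ) (hφ : (Function.support φ).Finite)
    (hφskew : ∀ x y : V, (x, y) ∈ T.E → φ (x, y) = - φ (y, x))
    (x : V) :
    deltaZero T (fun p => (f p.1 + f p.2) / 2 * φ p) x
      = f x * deltaZero T φ x
        - (2 * (T.c x : ℂ))⁻¹ *
          ∑ᶠ y ∈ {y : V | (x, y) ∈ T.E},
            (T.r x y : ℂ) * Complex.exp (- (Complex.I * (T.α x y : ℂ) / 2)) *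
              (f y - f x) * φ (x, y) := by
  have hset : {y : V | (y, x) ∈ T.E} = {y : V | (x, y) ∈ T.E} :=
    Set.ext fun y => ⟨T.E_symm y x, T.E_symm x y⟩
  simp only [deltaZero, hset, finsum_mem_eq_finite_toFinset_sum _ (T.locally_finite x),
    Finset.mul_sum, ← Finset.sum_sub_distrib]
  refine Finset.sum_congr rfl fun y hy => ?_
  have hxy : (x, y) ∈ T.E := by simpa using hy
  have hexp : -(Complex.I * (T.α x y : ℂ) / 2) = Complex.I * (T.α y x : ℂ) / 2 := by
    rw [T.α_skew x y hxy]
    push_cast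
    ring
  rw [hexp, hφskew x y hxy, T.r_symm x y, mul_inv]
  ring
end

section
/- The co-exterior magnetic derivative is the formal adjoint of the exterior magnetic derivative: for every finitely supported skewsymmetric φ : E → ℂ and every finitely supported skewsymmetric ψ : F → ℂ, one has (1/6) ∑_{(x,y,z)∈F} s(x,y,z) (d¹_α φ)(x,y,z) · conj(ψ(x,y,z)) = (1/2) ∑_{(x,y)∈E} r(x,y) φ(x,y) · conj((δ¹_α ψ)(x,y)), where (δ¹_α ψ)(x,y) = (1/r(x,y)) ∑_{t ∈ F_{xy}} s(x,y,t) e^{(i/6)(α(t,x)+α(t,y))} ψ(x,y,t). -/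
open Complex Function

open scoped Classical

variable {V : Type*}

/-- The common density of the two pairings: the term of the pairing of `d¹_α φ` with `ψ` in which
`φ` is evaluated on the edge joining the first two vertices of the face. -/
noncomputable def pairingDensity (T : MagneticTriangulation V) (φ : V × V → ℂ)
    (ψ : V × V × V → ℂ) : V × V × V → ℂ :=
  T.F.indicator fun q => (T.s q.1 q.2.1 q.2.2 : ℂ) *
    (Complex.exp (Complex.I / 6 * ((T.α q.1 q.2.2 + T.α q.2.1 q.2.2 : ℝ) : ℂ)) *
      φ (q.1, q.2.1)) * (starRingEnd ℂ) (ψ q)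

/-- Cyclic rotation of triples. -/
def rotateTriple (V : Type*) : V × V × V ≃ V × V × V where
  toFun q := (q.2.1, q.2.2, q.1)
  invFun q := (q.2.2, q.1, q.2.1)
  left_inv _ := rfl
  right_inv _ := rfl

lemma support_pairingDensity_finite (T : MagneticTriangulation V) (φ : V × V → ℂ)
    {ψ : V × V × V → ℂ} (hψ : (Function.support ψ).Finite) :
    (Function.support (pairingDensity T φ ψ)).Finite := by
  refine hψ.subset fun q hq hψq => hq ?_
  simp [pairingDensity, Set.indicator_apply, hψq]

/-- A face-skewsymmetric cochain pairs with `d¹_α φ` through three rotated densities. -/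
lemma mul_dOne_mul_conj_eq (T : MagneticTriangulation V) (φ : V × V → ℂ) (ψ : V × V × V → ℂ)
    (hψskew : ∀ x y z : V, (x, y, z) ∈ T.F → ψ (x, y, z) = - ψ (x, z, y))
    (hψskew' : ∀ x y z : V, (x, y, z) ∈ T.F → ψ (x, y, z) = - ψ (y, x, z)) (q : V × V × V) :
    T.F.indicator (fun q => (T.s q.1 q.2.1 q.2.2 : ℂ) * dOne T φ q * (starRingEnd ℂ) (ψ q)) q
      = pairingDensity T φ ψ q + pairingDensity T φ ψ (rotateTriple V q)
        + pairingDensity T φ ψ (rotateTriple V (rotateTriple V q)) := by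
  obtain ⟨x, y, z⟩ := q
  have hcyc : ∀ a b c, (a, b, c) ∈ T.F → ψ (b, c, a) = ψ (a, b, c) := fun a b c h => by
    rw [hψskew b c a (T.F_symm_cyc _ _ _ h), hψskew' a b c h]
  by_cases h : (x, y, z) ∈ T.F
  · have h₁ := T.F_symm_cyc _ _ _ h
    have h₂ := T.F_symm_cyc _ _ _ h₁
    simp only [pairingDensity, rotateTriple, Equiv.coe_fn_mk, Set.indicator_of_mem, h, h₁, h₂,
      dOne, if_true, hcyc _ _ _ h, hcyc _ _ _ h₁, ← T.s_symm_cyc y z x, ← T.s_symm_cyc x y z]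
    ring
  · have h₁ : (y, z, x) ∉ T.F := fun h' => h (T.F_symm_cyc _ _ _ (T.F_symm_cyc _ _ _ h'))
    have h₂ : (z, x, y) ∉ T.F := fun h' => h (T.F_symm_cyc _ _ _ h')
    simp [pairingDensity, rotateTriple, h, h₁, h₂]

/-- The pairing of `φ` with `δ¹_α ψ` at an edge is the density summed over the faces containing
that edge. -/
lemma mul_conj_deltaOne_eq (T : MagneticTriangulation V) (φ : V × V → ℂ) (ψ : V × V × V → ℂ)
    (p : V × V) :
    T.E.indicator (fun p => (T.r p.1 p.2 : ℂ) * φ p * (starRingEnd ℂ) (deltaOne T ψ p)) p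
      = ∑ᶠ t, pairingDensity T φ ψ (p.1, p.2, t) := by
  obtain ⟨x, y⟩ := p
  by_cases h : (x, y) ∈ T.E
  · have hr : (T.r x y : ℂ) ≠ 0 := by exact_mod_cast (T.r_pos x y h).ne'
    simp only [Set.indicator_of_mem h, deltaOne, map_mul, map_inv₀, Complex.conj_ofReal]
    have hconj : ∀ f : V → ℂ, (starRingEnd ℂ) (∑ᶠ t, f t) = ∑ᶠ t, (starRingEnd ℂ) (f t) :=
      (starRingEnd ℂ).toAddMonoidHom.map_finsum_of_injective (starRingEnd ℂ).injective
    rw [finsum_mem_def, hconj, ← mul_assoc, mul_right_comm (T.r x y : ℂ), mul_inv_cancel₀ hr,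
      one_mul, mul_finsum]
    refine finsum_congr fun t => ?_
    by_cases ht : (x, y, t) ∈ T.F
    · obtain ⟨-, hyt, htx⟩ := T.F_edge _ _ _ ht
      have ht' : t ∈ {t : V | (x, y, t) ∈ T.F} := ht
      simp only [pairingDensity, Set.indicator_of_mem ht, Set.indicator_of_mem ht',
        T.α_skew t x htx, T.α_skew y t hyt]
      simp only [map_mul, ← Complex.exp_conj, Complex.conj_ofReal, map_div₀, Complex.conj_I,
        map_ofNat]
      rw [show -I / 6 * ((-T.α x t + T.α t y : ℝ) : ℂ) = I / 6 * ((T.α x t + -T.α t y : ℝ) : ℂ) by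
        push_cast; ring]
      ring
    · simp [pairingDensity, ht]
  · have h₀ : ∀ t, pairingDensity T φ ψ (x, y, t) = 0 := fun t =>
      Set.indicator_of_notMem (fun ht => h (T.F_edge _ _ _ ht).1) _
    simp [h, h₀]

/-- **The co-exterior magnetic derivative is the formal adjoint of the exterior magnetic
derivative**: for every finitely supported skewsymmetric `φ` on the edges and every finitely
supported skewsymmetric `ψ` on the faces,
`(1/6) ∑_{(x,y,z)∈F} s(x,y,z) (d¹_α φ)(x,y,z) conj (ψ(x,y,z))
  = (1/2) ∑_{(x,y)∈E} r(x,y) φ(x,y) conj ((δ¹_α ψ)(x,y))`. -/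
theorem deltaOne_formal_adjoint_dOne [Countable V] (T : MagneticTriangulation V)
    (φ : V × V → ℂ) (hφ : (Function.support φ).Finite)
    (hφskew : ∀ x y : V, (x, y) ∈ T.E → φ (x, y) = - φ (y, x))
    (ψ : V × V × V → ℂ) (hψ : (Function.support ψ).Finite)
    (hψskew : ∀ x y z : V, (x, y, z) ∈ T.F → ψ (x, y, z) = - ψ (x, z, y))
    (hψskew' : ∀ x y z : V, (x, y, z) ∈ T.F → ψ (x, y, z) = - ψ (y, x, z)) :
    (1 / 6 : ℂ) * ∑ᶠ q ∈ T.F, (T.s q.1 q.2.1 q.2.2 : ℂ) * dOne T φ q * (starRingEnd ℂ) (ψ q)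
      = (1 / 2 : ℂ) * ∑ᶠ p ∈ T.E, (T.r p.1 p.2 : ℂ) * φ p * (starRingEnd ℂ) (deltaOne T ψ p) := by
  have hG := support_pairingDensity_finite T φ hψ
  have hG₁ := hG.preimage (rotateTriple V).injective.injOn
  have hG₂ := hG₁.preimage (rotateTriple V).injective.injOn
  rw [finsum_mem_def, finsum_mem_def, finsum_congr (mul_dOne_mul_conj_eq T φ ψ hψskew hψskew'),
    finsum_congr (mul_conj_deltaOne_eq T φ ψ),
    finsum_add_distrib ((hG.union hG₁).subset (support_add _ _)) hG₂,
    finsum_add_distrib hG hG₁,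
    finsum_comp_equiv (rotateTriple V) (f := fun q => pairingDensity T φ ψ (rotateTriple V q)),
    finsum_comp_equiv (rotateTriple V), ← finsum_comp_equiv (Equiv.prodAssoc V V V),
    finsum_curry _ (hG.preimage (Equiv.prodAssoc V V V).injective.injOn)]
  simp only [Equiv.prodAssoc_apply]
  ring
end

section
/- Derivation property for the exterior magnetic derivative: for every finitely supported f : V → ℂ and every finitely supported skewsymmetric φ : E → ℂ, and for every face (x,y,z) ∈ F, one has d¹_α(f̃ φ)(x,y,z) = ((f(x)+f(y)+f(z))/3) · (d¹_α φ)(x,y,z) + (1/6) (d⁰f ∧_α φ)(x,y,z), where f̃(x,y) := (f(x)+f(y))/2 and d⁰f(x,y) := f(y) − f(x). -/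
open Complex Function

open scoped Classical

variable {V : Type*}

/-- The wedge product of a scalar-valued `1`-form `ξ` with a `1`-form `φ` with values in the
`α`-bundle, yielding a `2`-form with values in the `α`-bundle. -/
noncomputable def wedgeAlpha (T : MagneticTriangulation V) (ξ φ : V × V → ℂ) :
    V × V × V → ℂ :=
  fun q =>
    Complex.exp (- (Complex.I / 6 * ((T.α q.2.2 q.1 + T.α q.2.2 q.2.1 : ℝ) : ℂ))) *
      (ξ (q.2.2, q.1) + ξ (q.2.2, q.2.1)) * φ (q.1, q.2.1)
    + Complex.exp (- (Complex.I / 6 * ((T.α q.1 q.2.1 + T.α q.1 q.2.2 : ℝ) : ℂ))) *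
      (ξ (q.1, q.2.1) + ξ (q.1, q.2.2)) * φ (q.2.1, q.2.2)
    + Complex.exp (- (Complex.I / 6 * ((T.α q.2.1 q.2.2 + T.α q.2.1 q.1 : ℝ) : ℂ))) *
      (ξ (q.2.1, q.2.2) + ξ (q.2.1, q.1)) * φ (q.2.2, q.1)

/-- **Derivation property for the exterior magnetic derivative**: for every finitely supported
`f : V → ℂ`, every finitely supported skewsymmetric `φ` on the edges, and every face
`(x,y,z) ∈ F`,
`d¹_α(f̃ φ)(x,y,z) = ((f x + f y + f z)/3) (d¹_α φ)(x,y,z) + (1/6)(d⁰f ∧_α φ)(x,y,z)`. -/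
theorem dOne_derivation [Countable V] (T : MagneticTriangulation V)
    (f : V → ℂ) (hf : (Function.support f).Finite)
    (φ : V × V → ℂ) (hφ : (Function.support φ).Finite)
    (hφskew : ∀ x y : V, (x, y) ∈ T.E → φ (x, y) = - φ (y, x))
    (x y z : V) (hxyz : (x, y, z) ∈ T.F) :
    dOne T (fun p => (f p.1 + f p.2) / 2 * φ p) (x, y, z)
      = (f x + f y + f z) / 3 * dOne T φ (x, y, z)
        + (1 / 6 : ℂ) * wedgeAlpha T (fun p => f p.2 - f p.1) φ (x, y, z) := by
  obtain ⟨hxy, hyz, hzx⟩ := T.F_edge x y z hxyz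
  simp only [dOne, wedgeAlpha, if_pos hxyz]
  rw [T.α_skew x y hxy, T.α_skew y z hyz, T.α_skew z x hzx]
  have phase (a b : ℝ) :
      Complex.exp (-(Complex.I / 6 * ((-a + b : ℝ) : ℂ)))
        = Complex.exp (Complex.I / 6 * ((a + -b : ℝ) : ℂ)) := by
    congr 1
    push_cast
    ring
  simp only [phase]
  ring
end

section
/- Derivation property for the co-exterior magnetic derivative: for every finitely supported f : V → ℂ and every finitely supported skewsymmetric ψ : F → ℂ, and for every edge e = (x,y) ∈ E, one has δ¹_α(f̃̃ ψ)(x,y) = ((f(x)+f(y))/2) · (δ¹_α ψ)(x,y) + (1/(6 r(x,y))) ∑_{t ∈ F_{xy}} s(x,y,t) e^{(i/6)(α(t,x)+α(t,y))} ((f(t)−f(x)) + (f(t)−f(y))) ψ(x,y,t), where f̃̃(x,y,z) := (f(x)+f(y)+f(z))/3. -/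
open Complex Function

open scoped Classical

variable {V : Type*}

/-- Each edge of a magnetic triangulation lies in finitely many faces. -/
theorem MagneticTriangulation.finite_faces (T : MagneticTriangulation V) (x y : V) :
    {t : V | (x, y, t) ∈ T.F}.Finite :=
  (T.locally_finite y).subset fun t ht => (T.F_edge x y t ht).2.1

/-- **Derivation property for the co-exterior magnetic derivative**: for every finitely
supported `f : V → ℂ`, every finitely supported skewsymmetric `ψ` on the faces, and every edge
`(x,y) ∈ E`,
`δ¹_α(f̃̃ ψ)(x,y) = ((f x + f y)/2) (δ¹_α ψ)(x,y)
  + (1/(6 r(x,y))) ∑_{t ∈ F_{xy}} s(x,y,t) e^{(i/6)(α(t,x)+α(t,y))} ((f t − f x) + (f t − f y)) ψ(x,y,t)`,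
where `f̃̃(x,y,z) = (f x + f y + f z)/3`. -/
theorem deltaOne_derivation [Countable V] (T : MagneticTriangulation V)
    (f : V → ℂ) (hf : (Function.support f).Finite)
    (ψ : V × V × V → ℂ) (hψ : (Function.support ψ).Finite)
    (hψskew : ∀ x y z : V, (x, y, z) ∈ T.F → ψ (x, y, z) = - ψ (x, z, y))
    (hψskew' : ∀ x y z : V, (x, y, z) ∈ T.F → ψ (x, y, z) = - ψ (y, x, z))
    (x y : V) (hxy : (x, y) ∈ T.E) :
    deltaOne T (fun q => (f q.1 + f q.2.1 + f q.2.2) / 3 * ψ q) (x, y)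
      = (f x + f y) / 2 * deltaOne T ψ (x, y)
        + (6 * (T.r x y : ℂ))⁻¹ *
          ∑ᶠ t ∈ {t : V | (x, y, t) ∈ T.F},
            (T.s x y t : ℂ) * Complex.exp (Complex.I / 6 * ((T.α t x + T.α t y : ℝ) : ℂ)) *
              ((f t - f x) + (f t - f y)) * ψ (x, y, t) := by
  have hfin : {t : V | (x, y, t) ∈ T.F}.Finite := T.finite_faces x y
  simp only [deltaOne, finsum_mem_eq_finite_toFinset_sum _ hfin, mul_inv, Finset.mul_sum,
    ← Finset.sum_add_distrib]
  refine Finset.sum_congr rfl fun t _ => ?_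
  ring
end

section
/- Bohr–Sommerfeld condition: the composition d¹_α ∘ d⁰_α vanishes on all finitely supported f : V → ℂ if and only if sin(α̂(x,y,z)/6) = 0 for every face (x,y,z) ∈ F, where α̂(x,y,z) := α(x,y) + α(y,z) + α(z,x). In particular, if the holonomy α̂ vanishes on all faces then d¹_α ∘ d⁰_α = 0. -/
open Complex Function

open scoped Classical

variable {V : Type*}

/-- The difference of the two phases multiplying the value of a cochain at a vertex of a face. -/
lemma exp_phase_sub_exp_phase (m h : ℝ) :
    Complex.exp (Complex.I * ((m - h : ℝ) : ℂ)) - Complex.exp (Complex.I * ((m + h : ℝ) : ℂ))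
      = -2 * Complex.I * Complex.exp (Complex.I * (m : ℂ)) * (Real.sin h : ℂ) := by
  have h₁ : Complex.I * ((m - h : ℝ) : ℂ) = Complex.I * m + -h * Complex.I := by
    push_cast; ring
  have h₂ : Complex.I * ((m + h : ℝ) : ℂ) = Complex.I * m + h * Complex.I := by
    push_cast; ring
  rw [h₁, h₂, Complex.exp_add, Complex.exp_add, Complex.ofReal_sin, Complex.sin]
  linear_combination (Complex.exp (Complex.I * m) * (Complex.exp (-h * Complex.I)
    - Complex.exp (h * Complex.I))) * Complex.I_sq

/-- On a face, `d¹_α ∘ d⁰_α` is multiplication by `sin (α̂ / 6)` up to phases. -/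
lemma dOne_dZero_apply_of_mem (T : MagneticTriangulation V) (f : V → ℂ) {x y z : V}
    (hF : (x, y, z) ∈ T.F) :
    dOne T (dZero T f) (x, y, z) = -2 * Complex.I * (Real.sin (hatAlpha T x y z / 6) : ℂ) *
      (Complex.exp (Complex.I * ((T.α x y - T.α z x) / 3 : ℝ)) * f x
        + Complex.exp (Complex.I * ((T.α y z - T.α x y) / 3 : ℝ)) * f y
        + Complex.exp (Complex.I * ((T.α z x - T.α y z) / 3 : ℝ)) * f z) := by
  obtain ⟨hxy, hyz, hzx⟩ := T.F_edge x y z hF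
  have hx := exp_phase_sub_exp_phase ((T.α x y - T.α z x) / 3) (hatAlpha T x y z / 6)
  have hy := exp_phase_sub_exp_phase ((T.α y z - T.α x y) / 3) (hatAlpha T x y z / 6)
  have hz := exp_phase_sub_exp_phase ((T.α z x - T.α y z) / 3) (hatAlpha T x y z / 6)
  simp only [dOne, dZero, hF, hxy, hyz, hzx, if_true, T.α_skew _ _ (T.E_symm _ _ hxy),
    T.α_skew _ _ (T.E_symm _ _ hyz), T.α_skew _ _ (T.E_symm _ _ hzx)]
  trans (Complex.exp (Complex.I *
          (((T.α x y - T.α z x) / 3 - hatAlpha T x y z / 6 : ℝ) : ℂ)) -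
        Complex.exp (Complex.I *
          (((T.α x y - T.α z x) / 3 + hatAlpha T x y z / 6 : ℝ) : ℂ))) * f x +
      (Complex.exp (Complex.I *
          (((T.α y z - T.α x y) / 3 - hatAlpha T x y z / 6 : ℝ) : ℂ)) -
        Complex.exp (Complex.I *
          (((T.α y z - T.α x y) / 3 + hatAlpha T x y z / 6 : ℝ) : ℂ))) * f y +
      (Complex.exp (Complex.I *
          (((T.α z x - T.α y z) / 3 - hatAlpha T x y z / 6 : ℝ) : ℂ)) -
        Complex.exp (Complex.I *
          (((T.α z x - T.α y z) / 3 + hatAlpha T x y z / 6 : ℝ) : ℂ))) * f z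
  · simp only [mul_sub, sub_mul, ← mul_assoc, ← Complex.exp_add, hatAlpha]
    push_cast
    ring_nf
  · rw [hx, hy, hz]
    ring

/-- `d¹_α ∘ d⁰_α` vanishes as soon as `sin (α̂ / 6)` vanishes on all faces. -/
lemma dOne_dZero_eq_zero (T : MagneticTriangulation V)
    (h : ∀ x y z : V, (x, y, z) ∈ T.F → Real.sin (hatAlpha T x y z / 6) = 0) (f : V → ℂ) :
    dOne T (dZero T f) = 0 := by
  funext ⟨x, y, z⟩
  by_cases hF : (x, y, z) ∈ T.F
  · simp [dOne_dZero_apply_of_mem T f hF, h x y z hF]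
  · simp [dOne, hF]

/-- **Bohr–Sommerfeld condition**: the composition `d¹_α ∘ d⁰_α` vanishes on all finitely
supported `f : V → ℂ` if and only if `sin(α̂(x,y,z)/6) = 0` for every face `(x,y,z) ∈ F`.
In particular, if the holonomy `α̂` vanishes on all faces then `d¹_α ∘ d⁰_α = 0`. -/
theorem bohr_sommerfeld [Countable V] (T : MagneticTriangulation V) :
    ((∀ f : V → ℂ, (Function.support f).Finite → dOne T (dZero T f) = 0)
      ↔ ∀ x y z : V, (x, y, z) ∈ T.F → Real.sin (hatAlpha T x y z / 6) = 0)
    ∧ ((∀ x y z : V, (x, y, z) ∈ T.F → hatAlpha T x y z = 0) →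
        ∀ f : V → ℂ, (Function.support f).Finite → dOne T (dZero T f) = 0) := by
  refine ⟨⟨fun h x y z hF => ?_, fun h f _ => dOne_dZero_eq_zero T h f⟩,
    fun h f _ => dOne_dZero_eq_zero T (fun x y z hF => by simp [h x y z hF]) f⟩
  obtain ⟨hxy, -, hzx⟩ := T.F_edge x y z hF
  have hyx : y ≠ x := by
    rintro rfl
    exact T.no_loops _ hxy
  have hne : z ≠ x := by
    rintro rfl
    exact T.no_loops _ hzx
  have key := congrFun (h (Pi.single x 1)
    ((Set.finite_singleton x).subset Pi.support_single_subset)) (x, y, z)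
  rw [dOne_dZero_apply_of_mem T _ hF, Pi.single_eq_same, Pi.single_eq_of_ne hyx,
    Pi.single_eq_of_ne hne] at key
  have hsin : (Real.sin (hatAlpha T x y z / 6) : ℂ) = 0 := by
    simpa only [mul_zero, add_zero, mul_one, Pi.zero_apply, mul_eq_zero, Complex.exp_ne_zero,
      or_false, Complex.I_ne_zero, neg_eq_zero, OfNat.ofNat_ne_zero, false_or] using key
  exact_mod_cast hsin
end

section
/- Degree growth implies χ-completeness: fix an origin vertex O ∈ V and let |x| denote the combinatorial distance from O to x, and B_n := {x ∈ V : |x| ≤ n}. If there exists K > 0 such that for all sufficiently large n, sup_{x∈B_n} deg_V(x) ≤ K n² and sup_{(x,y)∈E, x∈B_n, y∈B_{n+1}∪B_{n-1}} deg_E(x,y) ≤ K n², where deg_V(x) := (1/c(x)) ∑_{y∼x} r(x,y) and deg_E(x,y) := (1/r(x,y)) ∑_{z∈F_{xy}} s(x,y,z), then the magnetic triangulation is χ-complete. -/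
open Complex Function

open scoped Classical

variable {V : Type*}

/-- The geometric hypothesis of `χ`-completeness of a weighted triangulation: an exhaustion
of the vertex set by finite sets together with cut-off functions whose derivatives on edges
(condition `C₁`) and on faces (condition `C₂`) are uniformly bounded. -/
def ChiComplete {V : Type*} (T : MagneticTriangulation V) : Prop :=
  ∃ C : ℝ, 0 < C ∧
    ∃ B : ℕ → Set V, Monotone B ∧ (∀ n, (B n).Finite) ∧ (⋃ n, B n) = Set.univ ∧
      ∃ χ : ℕ → V → ℝ,
        (∀ n, (Function.support (χ n)).Finite) ∧
        (∀ n x, 0 ≤ χ n x ∧ χ n x ≤ 1) ∧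
        (∀ n, ∀ x ∈ B n, χ n x = 1) ∧
        (∀ n x, (T.c x)⁻¹ *
            ∑ᶠ y ∈ {y : V | (x, y) ∈ T.E}, T.r x y * |χ n y - χ n x| ^ 2 ≤ C) ∧
        (∀ n x y, (x, y) ∈ T.E →
          (T.r x y)⁻¹ * ∑ᶠ t ∈ {t : V | (x, y, t) ∈ T.F},
              T.s x y t * |(χ n x - χ n t) + (χ n y - χ n t)| ^ 2 ≤ C)

/-- Bounded curvature for the magnetic potential, with constant `C`: for every vertex `x`,
`(1/c(x)) ∑_{e ∈ F_x} s(x,e⁻,e⁺) sin²(α̂(x,e⁻,e⁺)/6) ≤ C`, where `F_x` is the set of oriented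
edges joined to `x` by a face. -/
def BoundedCurvature {V : Type*} (T : MagneticTriangulation V) (C : ℝ) : Prop :=
  ∀ x : V, (T.c x)⁻¹ *
      ∑ᶠ p ∈ {p : V × V | (x, p.1, p.2) ∈ T.F},
        T.s x p.1 p.2 * Real.sin (hatAlpha T x p.1 p.2 / 6) ^ 2 ≤ C

/-- The space of finitely supported 0-cochains. -/
noncomputable def Cc0 (V : Type*) : Submodule ℂ (V → ℂ) where
  carrier := {f | (Function.support f).Finite}
  add_mem' := fun hf hg => Set.Finite.subset (hf.union hg) (Function.support_add _ _)
  zero_mem' := by simp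
  smul_mem' := fun a f hf => Set.Finite.subset hf (Function.support_const_smul_subset a f)

/-- The space of finitely supported skewsymmetric 1-cochains, supported on the edge set. -/
noncomputable def Cc1 {V : Type*} (T : MagneticTriangulation V) : Submodule ℂ (V × V → ℂ) where
  carrier := {φ | (Function.support φ).Finite ∧ (∀ p ∉ T.E, φ p = 0) ∧
    ∀ x y : V, φ (x, y) = - φ (y, x)}
  add_mem' := by
    rintro φ ψ ⟨h1, h2, h3⟩ ⟨g1, g2, g3⟩
    refine ⟨Set.Finite.subset (h1.union g1) (Function.support_add _ _), ?_, ?_⟩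
    · intro p hp; simp [h2 p hp, g2 p hp]
    · intro x y; simp only [Pi.add_apply, h3 x y, g3 x y]; ring
  zero_mem' := by refine ⟨by simp, by simp, by simp⟩
  smul_mem' := by
    rintro a φ ⟨h1, h2, h3⟩
    refine ⟨Set.Finite.subset h1 (Function.support_const_smul_subset a φ), ?_, ?_⟩
    · intro p hp; simp [h2 p hp]
    · intro x y; simp only [Pi.smul_apply, h3 x y, smul_eq_mul]; ring
  
/-- The space of finitely supported skewsymmetric 2-cochains, supported on the face set. -/
noncomputable def Cc2 {V : Type*} (T : MagneticTriangulation V) : Submodule ℂ (V × V × V → ℂ) where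
  carrier := {ψ | (Function.support ψ).Finite ∧ (∀ q ∉ T.F, ψ q = 0) ∧
    (∀ x y z : V, ψ (x, y, z) = - ψ (x, z, y)) ∧ (∀ x y z : V, ψ (x, y, z) = - ψ (y, x, z))}
  add_mem' := by
    rintro φ ψ ⟨h1, h2, h3, h4⟩ ⟨g1, g2, g3, g4⟩
    refine ⟨Set.Finite.subset (h1.union g1) (Function.support_add _ _), ?_, ?_, ?_⟩
    · intro q hq; simp [h2 q hq, g2 q hq]
    · intro x y z; simp only [Pi.add_apply, h3 x y z, g3 x y z]; ring
    · intro x y z; simp only [Pi.add_apply, h4 x y z, g4 x y z]; ring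
  zero_mem' := by refine ⟨by simp, by simp, by simp, by simp⟩
  smul_mem' := by
    rintro a ψ ⟨h1, h2, h3, h4⟩
    refine ⟨Set.Finite.subset h1 (Function.support_const_smul_subset a ψ), ?_, ?_, ?_⟩
    · intro q hq; simp [h2 q hq]
    · intro x y z; simp only [Pi.smul_apply, h3 x y z, smul_eq_mul]; ring
    · intro x y z; simp only [Pi.smul_apply, h4 x y z, smul_eq_mul]; ring

variable {V : Type*}

/-- `d⁰_α` as a linear map. -/
noncomputable def dZeroL (T : MagneticTriangulation V) : (V → ℂ) →ₗ[ℂ] (V × V → ℂ) where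
  toFun := dZero T
  map_add' := by
    intro f g; funext p; by_cases h : p ∈ T.E <;> simp [dZero, h] <;> ring
  map_smul' := by
    intro a f; funext p; by_cases h : p ∈ T.E <;> simp [dZero, h] <;> ring

/-- `δ⁰_α` as a linear map. -/
noncomputable def deltaZeroL (T : MagneticTriangulation V) : (V × V → ℂ) →ₗ[ℂ] (V → ℂ) where
  toFun := deltaZero T
  map_add' := by
    intro φ ψ
    funext x
    have hS : {y : V | (y, x) ∈ T.E}.Finite :=
      (T.locally_finite x).subset (fun y hy => T.E_symm y x hy)
    simp only [deltaZero, Pi.add_apply]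
    rw [show {y : V | (y, x) ∈ T.E} = (hS.toFinset : Set V) from
        (Set.Finite.coe_toFinset hS).symm]
    simp only [finsum_mem_coe_finset, Finset.mul_sum]
    rw [← Finset.sum_add_distrib]
    exact Finset.sum_congr rfl fun y _ => by ring
  map_smul' := by
    intro a φ
    funext x
    have hS : {y : V | (y, x) ∈ T.E}.Finite :=
      (T.locally_finite x).subset (fun y hy => T.E_symm y x hy)
    simp only [deltaZero, Pi.smul_apply, smul_eq_mul, RingHom.id_apply]
    rw [show {y : V | (y, x) ∈ T.E} = (hS.toFinset : Set V) from
        (Set.Finite.coe_toFinset hS).symm]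
    simp only [finsum_mem_coe_finset, Finset.mul_sum]
    exact Finset.sum_congr rfl fun y _ => by ring

/-- `d¹_α` as a linear map. -/
noncomputable def dOneL (T : MagneticTriangulation V) : (V × V → ℂ) →ₗ[ℂ] (V × V × V → ℂ) where
  toFun := dOne T
  map_add' := by
    intro f g; funext q; by_cases h : q ∈ T.F <;> simp [dOne, h] <;> ring
  map_smul' := by
    intro a f; funext q; by_cases h : q ∈ T.F <;> simp [dOne, h] <;> ring

/-- `δ¹_α` as a linear map. -/
noncomputable def deltaOneL (T : MagneticTriangulation V) : (V × V × V → ℂ) →ₗ[ℂ] (V × V → ℂ) where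
  toFun := deltaOne T
  map_add' := by
    intro ψ₁ ψ₂
    funext p
    have hS : {t : V | (p.1, p.2, t) ∈ T.F}.Finite :=
      (T.locally_finite p.2).subset (fun t ht => (T.F_edge p.1 p.2 t ht).2.1)
    simp only [deltaOne, Pi.add_apply]
    rw [show {t : V | (p.1, p.2, t) ∈ T.F} = (hS.toFinset : Set V) from
        (Set.Finite.coe_toFinset hS).symm]
    simp only [finsum_mem_coe_finset, Finset.mul_sum]
    rw [← Finset.sum_add_distrib]
    exact Finset.sum_congr rfl fun t _ => by ring
  map_smul' := by
    intro a ψ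
    funext p
    have hS : {t : V | (p.1, p.2, t) ∈ T.F}.Finite :=
      (T.locally_finite p.2).subset (fun t ht => (T.F_edge p.1 p.2 t ht).2.1)
    simp only [deltaOne, Pi.smul_apply, smul_eq_mul, RingHom.id_apply]
    rw [show {t : V | (p.1, p.2, t) ∈ T.F} = (hS.toFinset : Set V) from
        (Set.Finite.coe_toFinset hS).symm]
    simp only [finsum_mem_coe_finset, Finset.mul_sum]
    exact Finset.sum_congr rfl fun t _ => by ring

lemma dZero_mem (T : MagneticTriangulation V) {f : V → ℂ} (hf : f ∈ Cc0 V) :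
    dZero T f ∈ Cc1 T := by
  refine ⟨?_, ?_, ?_⟩
  · have hsub : Function.support (dZero T f) ⊆
        ⋃ x ∈ Function.support f,
          ({x} ×ˢ {y : V | (x, y) ∈ T.E} ∪ {y : V | (x, y) ∈ T.E} ×ˢ {x}) := by
      rintro ⟨a, b⟩ hp
      simp only [Function.mem_support, dZero] at hp
      by_cases hE : (a, b) ∈ T.E
      · rw [if_pos hE] at hp
        by_cases ha : f a = 0
        · have hb : f b ≠ 0 := by
            intro hb; exact hp (by rw [ha, hb]; ring)
          refine Set.mem_biUnion hb ?_
          exact Or.inr ⟨T.E_symm a b hE, rfl⟩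
        · refine Set.mem_biUnion ha ?_
          exact Or.inl ⟨rfl, hE⟩
      · exact absurd (if_neg hE) hp
    exact Set.Finite.subset
      (Set.Finite.biUnion hf (fun x _ =>
        (((Set.finite_singleton x).prod (T.locally_finite x)).union
          ((T.locally_finite x).prod (Set.finite_singleton x))))) hsub
  · intro p hp; simp only [dZero, if_neg hp]
  · intro x y
    by_cases hE : (x, y) ∈ T.E
    · have hE' : (y, x) ∈ T.E := T.E_symm x y hE
      simp only [dZero, if_pos hE, if_pos hE']
      ring
    · have hE' : (y, x) ∉ T.E := fun h => hE (T.E_symm y x h)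
      simp only [dZero, if_neg hE, if_neg hE', neg_zero]

lemma deltaZero_mem (T : MagneticTriangulation V) {φ : V × V → ℂ} (hφ : φ ∈ Cc1 T) :
    deltaZero T φ ∈ Cc0 V := by
  have hsub : Function.support (deltaZero T φ) ⊆ Prod.snd '' Function.support φ := by
    intro x hx
    simp only [Function.mem_support, deltaZero] at hx
    have hx' : ∑ᶠ y ∈ {y : V | (y, x) ∈ T.E},
        (T.r y x : ℂ) * Complex.exp (Complex.I * (T.α y x : ℂ) / 2) * φ (y, x) ≠ 0 := by
      intro h; exact hx (by rw [h, mul_zero])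
    obtain ⟨y, -, hy⟩ := exists_ne_zero_of_finsum_mem_ne_zero hx'
    have : φ (y, x) ≠ 0 := by
      intro h; exact hy (by rw [h, mul_zero])
    exact ⟨(y, x), this, rfl⟩
  exact Set.Finite.subset (hφ.1.image Prod.snd) hsub

lemma dOne_mem (T : MagneticTriangulation V) {φ : V × V → ℂ} (hφ : φ ∈ Cc1 T) :
    dOne T φ ∈ Cc2 T := by
  obtain ⟨hfin, hsupp, hskew⟩ := hφ
  refine ⟨?_, ?_, ?_, ?_⟩
  · have hsub : Function.support (dOne T φ) ⊆
        ⋃ p ∈ Function.support φ,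
          ({p.1} ×ˢ {p.2} ×ˢ {y : V | (p.2, y) ∈ T.E}
            ∪ {y : V | (p.2, y) ∈ T.E} ×ˢ {p.1} ×ˢ {p.2}
            ∪ {p.2} ×ˢ {y : V | (p.2, y) ∈ T.E} ×ˢ {p.1}) := by
      rintro ⟨x, y, z⟩ hq
      simp only [Function.mem_support, dOne] at hq
      by_cases hF : (x, y, z) ∈ T.F
      · rw [if_pos hF] at hq
        obtain ⟨hxy, hyz, hzx⟩ := T.F_edge x y z hF
        by_cases h1 : φ (x, y) ≠ 0
        · exact Set.mem_biUnion h1 (Or.inl (Or.inl ⟨rfl, rfl, hyz⟩))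
        by_cases h2 : φ (y, z) ≠ 0
        · exact Set.mem_biUnion h2 (Or.inl (Or.inr ⟨hzx, rfl, rfl⟩))
        by_cases h3 : φ (z, x) ≠ 0
        · exact Set.mem_biUnion h3 (Or.inr ⟨rfl, hxy, rfl⟩)
        · push_neg at h1 h2 h3
          exact absurd (by rw [h1, h2, h3]; ring) hq
      · exact absurd (if_neg hF) hq
    exact Set.Finite.subset
      (Set.Finite.biUnion hfin (fun p _ =>
        (((Set.finite_singleton p.1).prod
            ((Set.finite_singleton p.2).prod (T.locally_finite p.2))).union
          ((T.locally_finite p.2).prod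
            ((Set.finite_singleton p.1).prod (Set.finite_singleton p.2)))).union
          ((Set.finite_singleton p.2).prod
            ((T.locally_finite p.2).prod (Set.finite_singleton p.1))))) hsub
  · intro q hq; simp only [dOne, if_neg hq]
  · intro x y z
    by_cases hF : (x, y, z) ∈ T.F
    · have hF' : (x, z, y) ∈ T.F := T.F_symm_cyc _ _ _ (T.F_symm_swap _ _ _ hF)
      simp only [dOne, if_pos hF, if_pos hF']
      rw [hskew x z, hskew z y, hskew y x]
      ring_nf
    · have hF' : (x, z, y) ∉ T.F :=
        fun h => hF (T.F_symm_cyc _ _ _ (T.F_symm_swap _ _ _ h))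
      simp only [dOne, if_neg hF, if_neg hF', neg_zero]
  · intro x y z
    by_cases hF : (x, y, z) ∈ T.F
    · have hF' : (y, x, z) ∈ T.F := T.F_symm_swap _ _ _ hF
      simp only [dOne, if_pos hF, if_pos hF']
      rw [hskew y x, hskew x z, hskew z y]
      ring_nf
    · have hF' : (y, x, z) ∉ T.F := fun h => hF (T.F_symm_swap _ _ _ h)
      simp only [dOne, if_neg hF, if_neg hF', neg_zero]

lemma deltaOne_mem (T : MagneticTriangulation V) {ψ : V × V × V → ℂ} (hψ : ψ ∈ Cc2 T) :
    deltaOne T ψ ∈ Cc1 T := by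
  obtain ⟨hfin, hsupp, hsk1, hsk2⟩ := hψ
  refine ⟨?_, ?_, ?_⟩
  · have hsub : Function.support (deltaOne T ψ) ⊆
        (fun q : V × V × V => (q.1, q.2.1)) '' Function.support ψ := by
      rintro ⟨x, y⟩ hp
      simp only [Function.mem_support, deltaOne] at hp
      have hp' : ∑ᶠ t ∈ {t : V | (x, y, t) ∈ T.F},
          (T.s x y t : ℂ) * Complex.exp (Complex.I / 6 * ((T.α t x + T.α t y : ℝ) : ℂ)) *
            ψ (x, y, t) ≠ 0 := by
        intro h; exact hp (by rw [h, mul_zero])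
      obtain ⟨t, -, ht⟩ := exists_ne_zero_of_finsum_mem_ne_zero hp'
      have : ψ (x, y, t) ≠ 0 := by intro h; exact ht (by rw [h, mul_zero])
      exact ⟨(x, y, t), this, rfl⟩
    exact Set.Finite.subset (hfin.image _) hsub
  · intro p hp
    have hempty : {t : V | (p.1, p.2, t) ∈ T.F} = ∅ := by
      ext t
      simp only [Set.mem_setOf_eq, Set.mem_empty_iff_false, iff_false]
      exact fun h => hp (T.F_edge _ _ _ h).1
    simp only [deltaOne, hempty, finsum_mem_empty, mul_zero]
  · intro x y
    simp only [deltaOne]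
    have hset : {t : V | (y, x, t) ∈ T.F} = {t : V | (x, y, t) ∈ T.F} := by
      ext t
      exact ⟨fun h => T.F_symm_swap _ _ _ h, fun h => T.F_symm_swap _ _ _ h⟩
    have hsum : ∑ᶠ t ∈ {t : V | (y, x, t) ∈ T.F},
        (T.s y x t : ℂ) * Complex.exp (Complex.I / 6 * ((T.α t y + T.α t x : ℝ) : ℂ)) *
          ψ (y, x, t)
        = ∑ᶠ t ∈ {t : V | (x, y, t) ∈ T.F},
            -((T.s x y t : ℂ) * Complex.exp (Complex.I / 6 * ((T.α t x + T.α t y : ℝ) : ℂ)) *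
              ψ (x, y, t)) := by
      rw [hset]
      refine finsum_mem_congr rfl (fun t ht => ?_)
      rw [show T.s y x t = T.s x y t from T.s_symm_swap y x t,
        show T.α t y + T.α t x = T.α t x + T.α t y from add_comm _ _,
        hsk2 x y t]
      ring
    have hSfin : {t : V | (x, y, t) ∈ T.F}.Finite :=
      (T.locally_finite y).subset (fun t ht => (T.F_edge x y t ht).2.1)
    rw [T.r_symm y x, hsum,
      show {t : V | (x, y, t) ∈ T.F} = (hSfin.toFinset : Set V) from
        (Set.Finite.coe_toFinset hSfin).symm,
      finsum_mem_coe_finset, finsum_mem_coe_finset, Finset.sum_neg_distrib]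
    ring

/-- `d⁰_α` restricted to finitely supported cochains. -/
noncomputable def dZeroR (T : MagneticTriangulation V) : ↥(Cc0 V) →ₗ[ℂ] ↥(Cc1 T) :=
  (dZeroL T).restrict (p := Cc0 V) (q := Cc1 T) (fun _ hf => dZero_mem T hf)

/-- `δ⁰_α` restricted to finitely supported cochains. -/
noncomputable def deltaZeroR (T : MagneticTriangulation V) : ↥(Cc1 T) →ₗ[ℂ] ↥(Cc0 V) :=
  (deltaZeroL T).restrict (p := Cc1 T) (q := Cc0 V) (fun _ hφ => deltaZero_mem T hφ)

/-- `d¹_α` restricted to finitely supported cochains. -/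
noncomputable def dOneR (T : MagneticTriangulation V) : ↥(Cc1 T) →ₗ[ℂ] ↥(Cc2 T) :=
  (dOneL T).restrict (p := Cc1 T) (q := Cc2 T) (fun _ hφ => dOne_mem T hφ)

/-- `δ¹_α` restricted to finitely supported cochains. -/
noncomputable def deltaOneR (T : MagneticTriangulation V) : ↥(Cc2 T) →ₗ[ℂ] ↥(Cc1 T) :=
  (deltaOneL T).restrict (p := Cc2 T) (q := Cc1 T) (fun _ hψ => deltaOne_mem T hψ)

/-- Transporting a densely defined operator `D` on pre-Hilbert spaces of finitely supported
cochains to a partially defined operator between realizations `H`, `H'` of the corresponding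
`l²` spaces, via embeddings `J`, `J'` with dense range. The domain is the image of `J`. -/
noncomputable def pmapOf {M N H H' : Type*}
    [AddCommGroup M] [Module ℂ M] [AddCommGroup N] [Module ℂ N]
    [AddCommGroup H] [Module ℂ H] [AddCommGroup H'] [Module ℂ H']
    (J : M →ₗ[ℂ] H) (hJ : Function.Injective J) (J' : N →ₗ[ℂ] H') (D : M →ₗ[ℂ] N) :
    H →ₗ.[ℂ] H' :=
  ⟨LinearMap.range J,
    J'.comp (D.comp ((LinearEquiv.ofInjective J hJ).symm.toLinearMap))⟩

/-- The `l²(V)` scalar product of 0-cochains (conjugate-linear in the first variable). -/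
noncomputable def innerV (T : MagneticTriangulation V) (f g : V → ℂ) : ℂ :=
  ∑ᶠ x : V, (T.c x : ℂ) * (starRingEnd ℂ) (f x) * g x

/-- The `l²(E)` scalar product of 1-cochains (conjugate-linear in the first variable). -/
noncomputable def innerE (T : MagneticTriangulation V) (φ ψ : V × V → ℂ) : ℂ :=
  (1 / 2 : ℂ) * ∑ᶠ p ∈ T.E, (T.r p.1 p.2 : ℂ) * (starRingEnd ℂ) (φ p) * ψ p

/-- The `l²(F)` scalar product of 2-cochains (conjugate-linear in the first variable). -/
noncomputable def innerF (T : MagneticTriangulation V) (ψ₁ ψ₂ : V × V × V → ℂ) : ℂ :=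
  (1 / 6 : ℂ) * ∑ᶠ q ∈ T.F, (T.s q.1 q.2.1 q.2.2 : ℂ) * (starRingEnd ℂ) (ψ₁ q) * ψ₂ q

/-- The combinatorial distance between two vertices: the minimal number of edges of a path
joining them. -/
noncomputable def cdist (T : MagneticTriangulation V) (x y : V) : ℕ :=
  sInf {n : ℕ | ∃ γ : ℕ → V, γ 0 = x ∧ γ n = y ∧ ∀ i < n, (γ i, γ (i + 1)) ∈ T.E}

/-- The weighted degree of a vertex. -/
noncomputable def degV (T : MagneticTriangulation V) (x : V) : ℝ :=
  (T.c x)⁻¹ * ∑ᶠ y ∈ {y : V | (x, y) ∈ T.E}, T.r x y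

/-- The weighted degree of an edge. -/
noncomputable def degE (T : MagneticTriangulation V) (x y : V) : ℝ :=
  (T.r x y)⁻¹ * ∑ᶠ z ∈ {z : V | (x, y, z) ∈ T.F}, T.s x y z

/-- Any two vertices are joined by a path realizing their combinatorial distance. -/
lemma exists_path_cdist (T : MagneticTriangulation V) (x y : V) :
    ∃ γ : ℕ → V, γ 0 = x ∧ γ (cdist T x y) = y ∧
      ∀ i < cdist T x y, (γ i, γ (i + 1)) ∈ T.E := by
  have hne : {n : ℕ | ∃ γ : ℕ → V, γ 0 = x ∧ γ n = y ∧
      ∀ i < n, (γ i, γ (i + 1)) ∈ T.E}.Nonempty := by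
    induction T.connected x y with
    | refl => exact ⟨0, fun _ => x, rfl, rfl, by simp⟩
    | @tail b c _ hbc ih =>
      obtain ⟨n, γ, h0, hn, hγ⟩ := ih
      refine ⟨n + 1, Function.update γ (n + 1) c, by simpa using h0, by simp, fun i hi => ?_⟩
      rw [Function.update_of_ne hi.ne]
      rcases Nat.lt_succ_iff_lt_or_eq.1 hi with h | rfl
      · rw [Function.update_of_ne (by omega)]
        exact hγ i h
      · rwa [Function.update_self, hn]
  exact Nat.sInf_mem hne

lemma cdist_le_of_path (T : MagneticTriangulation V) (γ : ℕ → V) (n : ℕ)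
    (hγ : ∀ i < n, (γ i, γ (i + 1)) ∈ T.E) : cdist T (γ 0) (γ n) ≤ n :=
  Nat.sInf_le ⟨γ, rfl, rfl, hγ⟩

lemma cdist_le_add_one_of_edge (T : MagneticTriangulation V) (O : V) {x y : V}
    (h : (x, y) ∈ T.E) : cdist T O y ≤ cdist T O x + 1 := by
  obtain ⟨γ, h0, hn, hγ⟩ := exists_path_cdist T O x
  refine Nat.sInf_le ⟨Function.update γ (cdist T O x + 1) y, by simpa using h0, by simp,
    fun i hi => ?_⟩
  rw [Function.update_of_ne hi.ne]
  rcases Nat.lt_succ_iff_lt_or_eq.1 hi with hlt | rfl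
  · rw [Function.update_of_ne (by omega)]
    exact hγ i hlt
  · rwa [Function.update_self, hn]

/-- Combinatorial balls are finite, by local finiteness. -/
lemma finite_cdist_le (T : MagneticTriangulation V) (O : V) (n : ℕ) :
    {x : V | cdist T O x ≤ n}.Finite := by
  induction n with
  | zero =>
    refine (Set.finite_singleton O).subset fun x hx => ?_
    obtain ⟨γ, h0, hn, -⟩ := exists_path_cdist T O x
    rw [Nat.le_zero.1 hx, h0] at hn
    exact hn.symm
  | succ n ih =>
    refine (ih.union (ih.biUnion fun x _ => T.locally_finite x)).subset fun y hy => ?_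
    obtain ⟨γ, h0, hn, hγ⟩ := exists_path_cdist T O y
    rcases Nat.le_succ_iff.1 hy with hle | heq
    · exact Or.inl hle
    · rw [Nat.succ_eq_add_one] at heq
      rw [heq] at hn hγ
      refine Or.inr (Set.mem_biUnion (x := γ n) ?_ ?_)
      · have := cdist_le_of_path T γ n fun i hi => hγ i (by omega)
        rwa [h0] at this
      · have := hγ n (by omega)
        rwa [hn] at this

/-- The radial cut-off profile: equal to `1` on `[0, m]`, to `0` on `[2m, ∞)`, and affine in
between. -/
noncomputable def cutoff (m d : ℕ) : ℝ := max (min ((2 * m - d) / m) 1) 0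

lemma cutoff_mem_Icc (m d : ℕ) : 0 ≤ cutoff m d ∧ cutoff m d ≤ 1 :=
  ⟨le_max_right _ _, max_le (min_le_right _ _) zero_le_one⟩

lemma cutoff_eq_one {m d : ℕ} (hm : 0 < m) (h : d ≤ m) : cutoff m d = 1 := by
  have hm' : (0 : ℝ) < m := by exact_mod_cast hm
  have h' : (d : ℝ) ≤ m := by exact_mod_cast h
  rw [cutoff, min_eq_right, max_eq_left zero_le_one]
  rw [le_div_iff₀ hm']
  linarith

lemma cutoff_eq_zero {m d : ℕ} (h : 2 * m ≤ d) : cutoff m d = 0 := by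
  have h' : (2 * m : ℝ) ≤ d := by exact_mod_cast h
  exact max_eq_right ((min_le_left _ _).trans
    (div_nonpos_of_nonpos_of_nonneg (by linarith) m.cast_nonneg))

lemma abs_cutoff_sub_cutoff_le {m d e : ℕ} (hde : d ≤ e + 1) (hed : e ≤ d + 1) :
    |cutoff m d - cutoff m e| ≤ (m : ℝ)⁻¹ := by
  have h1 : (d : ℝ) ≤ e + 1 := by exact_mod_cast hde
  have h2 : (e : ℝ) ≤ d + 1 := by exact_mod_cast hed
  have h3 : |((e : ℝ) - d)| ≤ 1 := abs_le.2 ⟨by linarith, by linarith⟩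
  calc |cutoff m d - cutoff m e|
      ≤ |min ((2 * m - d) / m : ℝ) 1 - min ((2 * m - e) / m : ℝ) 1| :=
        abs_max_sub_max_le_abs _ _ _
    _ ≤ max |((2 * m - d) / m : ℝ) - (2 * m - e) / m| |(1 : ℝ) - 1| :=
        abs_min_sub_min_le_max _ _ _ _
    _ = |((2 * m - d) / m : ℝ) - (2 * m - e) / m| := by simp
    _ = |(e : ℝ) - d| * (m : ℝ)⁻¹ := by
        rw [← sub_div, div_eq_mul_inv, abs_mul,
          abs_of_nonneg (a := (m : ℝ)⁻¹) (inv_nonneg.2 m.cast_nonneg)]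
        ring_nf
    _ ≤ (m : ℝ)⁻¹ := mul_le_of_le_one_left (inv_nonneg.2 m.cast_nonneg) h3

lemma abs_cutoff_cdist_sub_le (T : MagneticTriangulation V) (O : V) (m : ℕ) {x y : V}
    (h : (x, y) ∈ T.E) :
    |cutoff m (cdist T O x) - cutoff m (cdist T O y)| ≤ (m : ℝ)⁻¹ :=
  abs_cutoff_sub_cutoff_le (cdist_le_add_one_of_edge T O (T.E_symm x y h))
    (cdist_le_add_one_of_edge T O h)

/-- A weighted sum is bounded by the total weight times a bound on the summands. -/
lemma mul_finsum_mem_mul_le {ι : Type*} {S : Set ι} (hS : S.Finite) {a b : ℝ} (ha : 0 ≤ a)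
    {w f : ι → ℝ} (hw : ∀ t ∈ S, 0 ≤ w t) (hf : ∀ t ∈ S, f t ≤ b) :
    a * ∑ᶠ t ∈ S, w t * f t ≤ (a * ∑ᶠ t ∈ S, w t) * b := by
  rw [mul_assoc, finsum_mem_mul, finsum_mem_eq_finite_toFinset_sum _ hS,
    finsum_mem_eq_finite_toFinset_sum _ hS]
  refine mul_le_mul_of_nonneg_left (Finset.sum_le_sum fun t ht => ?_) ha
  have ht' := hS.mem_toFinset.1 ht
  exact mul_le_mul_of_nonneg_left (hf t ht') (hw t ht')

/-- Quadratic growth at radius `2m + 1` is compensated by a factor `m⁻²`. -/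
lemma growth_mul_inv_sq_le {K : ℝ} (hK : 0 < K) {m : ℕ} (hm : 0 < m) :
    K * ((2 * m + 1 : ℕ) : ℝ) ^ 2 * (2 * (m : ℝ)⁻¹) ^ 2 ≤ 36 * K := by
  have hm' : (1 : ℝ) ≤ m := by exact_mod_cast hm
  have h : ((2 * m + 1 : ℕ) : ℝ) * (2 * (m : ℝ)⁻¹) ≤ 6 := by
    rw [← div_eq_mul_inv, ← mul_div_assoc, div_le_iff₀ (by linarith)]
    push_cast
    linarith
  have h' : (((2 * m + 1 : ℕ) : ℝ) * (2 * (m : ℝ)⁻¹)) ^ 2 ≤ 6 ^ 2 :=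
    pow_le_pow_left₀ (by positivity) h 2
  rw [mul_assoc, ← mul_pow]
  linarith [mul_le_mul_of_nonneg_left h' hK.le]

/-- **Degree growth implies `χ`-completeness** (Theorem 8.1): fix an origin `O ∈ V` and let
`B_n` be the combinatorial ball of radius `n` around `O`.  If for some `K > 0` and all
sufficiently large `n` one has `sup_{x ∈ B_n} deg_V(x) ≤ K n²` and
`sup_{(x,y) ∈ E, x ∈ B_n, y ∈ B_{n+1} ∪ B_{n-1}} deg_E(x,y) ≤ K n²`, then the magnetic
triangulation is `χ`-complete. -/
theorem chiComplete_of_degree_growth [Countable V] (T : MagneticTriangulation V) (O : V)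
    (hK : ∃ K : ℝ, 0 < K ∧ ∃ N : ℕ, ∀ n : ℕ, N ≤ n →
      (∀ x : V, cdist T O x ≤ n → degV T x ≤ K * (n : ℝ) ^ 2) ∧
      (∀ x y : V, (x, y) ∈ T.E → cdist T O x ≤ n →
        (cdist T O y ≤ n + 1 ∨ cdist T O y ≤ n - 1) → degE T x y ≤ K * (n : ℝ) ^ 2)) :
    ChiComplete T := by
  obtain ⟨K, hK0, N, hN⟩ := hK
  have hm (n : ℕ) : 0 < n + N + 1 := by omega
  refine ⟨36 * K, by positivity, fun n => {x | cdist T O x ≤ n + N + 1},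
    fun a b hab x (hx : cdist T O x ≤ a + N + 1) =>
      show cdist T O x ≤ b + N + 1 by omega, fun n => finite_cdist_le T O _, ?_,
    fun n x => cutoff (n + N + 1) (cdist T O x), fun n => ?_, fun n x => cutoff_mem_Icc _ _,
    fun n x hx => cutoff_eq_one (hm n) hx, fun n x => ?_, fun n x y hxy => ?_⟩
  · refine Set.eq_univ_of_forall fun x => Set.mem_iUnion.2 ⟨cdist T O x, ?_⟩
    show cdist T O x ≤ cdist T O x + N + 1
    omega
  · refine (finite_cdist_le T O (2 * (n + N + 1))).subset fun x hx => ?_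
    by_contra hlt
    exact hx (cutoff_eq_zero (not_le.1 hlt).le)
  · beta_reduce
    generalize hM : n + N + 1 = m
    by_cases hx : cdist T O x ≤ 2 * m + 1
    · refine (mul_finsum_mem_mul_le (T.locally_finite x) (inv_nonneg.2 (T.c_pos x).le)
        (b := (2 * (m : ℝ)⁻¹) ^ 2) (fun y hy => (T.r_pos x y hy).le) fun y hy => ?_).trans ?_
      · refine pow_le_pow_left₀ (abs_nonneg _) ?_ 2
        have := abs_cutoff_cdist_sub_le T O m (T.E_symm x y hy)
        linarith [inv_nonneg.2 (m.cast_nonneg (α := ℝ))]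
      · exact (mul_le_mul_of_nonneg_right ((hN (2 * m + 1) (by omega)).1 x hx)
          (sq_nonneg _)).trans (growth_mul_inv_sq_le hK0 (by omega))
    · rw [finsum_mem_eq_zero_of_forall_eq_zero, mul_zero]
      · positivity
      · intro y hy
        have := cdist_le_add_one_of_edge T O (T.E_symm x y hy)
        rw [cutoff_eq_zero (d := cdist T O x) (by omega),
          cutoff_eq_zero (d := cdist T O y) (by omega)]
        simp
  · beta_reduce
    generalize hM : n + N + 1 = m
    by_cases hx : cdist T O x ≤ 2 * m + 1
    · have hS : {t : V | (x, y, t) ∈ T.F}.Finite :=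
        (T.locally_finite y).subset fun t ht => (T.F_edge x y t ht).2.1
      refine (mul_finsum_mem_mul_le hS (inv_nonneg.2 (T.r_pos x y hxy).le)
        (b := (2 * (m : ℝ)⁻¹) ^ 2) (fun t ht => (T.s_pos x y t ht).le) fun t ht => ?_).trans ?_
      · obtain ⟨-, hyt, htx⟩ := T.F_edge x y t ht
        refine pow_le_pow_left₀ (abs_nonneg _) ((abs_add_le _ _).trans ?_) 2
        linarith [abs_cutoff_cdist_sub_le T O m (T.E_symm t x htx),
          abs_cutoff_cdist_sub_le T O m hyt]
      · have hy := cdist_le_add_one_of_edge T O hxy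
        exact (mul_le_mul_of_nonneg_right
          ((hN (2 * m + 1) (by omega)).2 x y hxy hx (Or.inl (by omega)))
          (sq_nonneg _)).trans (growth_mul_inv_sq_le hK0 (by omega))
    · rw [finsum_mem_eq_zero_of_forall_eq_zero, mul_zero]
      · positivity
      · intro t ht
        have hy := cdist_le_add_one_of_edge T O (T.E_symm x y hxy)
        have ht' := cdist_le_add_one_of_edge T O (T.F_edge x y t ht).2.2
        rw [cutoff_eq_zero (d := cdist T O x) (by omega),
          cutoff_eq_zero (d := cdist T O y) (by omega),
          cutoff_eq_zero (d := cdist T O t) (by omega)]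
        simp
end
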